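/- arXiv:2110.01602 — 2 statements merged into one kernel-verified Lean document; each statement's English description precedes it below -/
import Mathlib

section
/- Let μ* ∈ ℝ^d, let Σ* ∈ ℝ^{d×d} be positive definite, and let x be a random vector with law (1/2) N(μ*, Σ*) + (1/2) N(−μ*, Σ*). Let f : ℝ → ℝ be continuous with f(t) = f(−t) for all t, twice continuously differentiable on ℝ ∖ {0}, and with liminf_{t→+∞} f'(t) > 0. Assume E[f(β^T x)], E[x f'(β^T x)] and E[x x^T f''(β^T x)] are well defined for all β, and that F(β) := E[f(β^T x)] satisfies ∇F(β) = E[x f'(β^T x)] and ∇²F(β) = E[x x^T f''(β^T x)] for all β ≠ 0. Suppose in addition that either (i) lim_{t→0+} f'(t) exists and is negative, or (ii) f''(0) exists and f''(0) < 0. Then for every β ≠ 0 with ⟨β, μ*⟩ = 0 there exist t₀ > 0 and a ≥ 0 such that ∇F(t₀ β) = 0 and ∇²F(t₀ β) = a (Σ* β)(Σ* β)^T; in particular ∇²F(t₀ β) is positive semidefinite. -/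
open MeasureTheory Real Matrix Filter
open scoped ENNReal

noncomputable section

/-- Density of the `d`-dimensional Gaussian distribution `N(μ, S)` at `x`. -/
def gaussDensity {d : ℕ} (μ : Fin d → ℝ) (S : Matrix (Fin d) (Fin d) ℝ) (x : Fin d → ℝ) : ℝ :=
  (2 * π) ^ (-(d : ℝ) / 2) * S.det ^ (-(1 : ℝ) / 2) *
    Real.exp (-(1 / 2) * ((x - μ) ⬝ᵥ (S⁻¹ *ᵥ (x - μ))))

/-- The symmetric two-component Gaussian mixture `½ N(μ, S) + ½ N(-μ, S)`. -/
def symMix {d : ℕ} (μ : Fin d → ℝ) (S : Matrix (Fin d) (Fin d) ℝ) : Measure (Fin d → ℝ) :=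
  volume.withDensity fun x =>
    ENNReal.ofReal (1 / 2 * gaussDensity μ S x + 1 / 2 * gaussDensity (-μ) S x)

open ProbabilityTheory

/-- A positive definite matrix `S` has a square root factor `A` (with `A * Aᵀ = S`) whose
transpose sends a prescribed nonzero vector to a positive multiple of a basis vector. -/
lemma Matrix.PosDef.exists_factor_transpose_mulVec_eq_single {n : Type*} [Fintype n]
    [DecidableEq n] {S : Matrix n n ℝ} (hS : S.PosDef) {b : n → ℝ} (hb : b ≠ 0) (i₀ : n) :
    ∃ A : Matrix n n ℝ, A * Aᵀ = S ∧ ∃ r : ℝ, 0 < r ∧ Aᵀ *ᵥ b = Pi.single i₀ r := by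
  obtain ⟨B, hB⟩ : ∃ B : Matrix n n ℝ, S = Bᵀ * B := by
    open scoped MatrixOrder in
    obtain ⟨B, hB⟩ := CStarAlgebra.nonneg_iff_eq_star_mul_self.mp hS.posSemidef.nonneg
    exact ⟨B, by simpa [star_eq_conjTranspose] using hB⟩
  let p : EuclideanSpace ℝ n := WithLp.toLp 2 (B *ᵥ b)
  have hp : p ≠ 0 := by
    intro h
    have h0 : B *ᵥ b = 0 := by simpa [p] using h
    have := hS.dotProduct_mulVec_pos hb
    rw [hB, ← mulVec_mulVec, h0] at this
    simp at this
  have hr : 0 < ‖p‖ := norm_pos_iff.mpr hp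
  obtain ⟨e, he⟩ := Orthonormal.exists_orthonormalBasis_extension_of_card_eq (𝕜 := ℝ)
    (E := EuclideanSpace ℝ n) (ι := n) (by simp) (v := fun _ => ‖p‖⁻¹ • p) (s := {i₀}) (by
      constructor
      · intro i
        simp [norm_smul, hr.ne']
      · intro i j hij
        exact absurd (Subsingleton.elim i j) hij)
  have he₀ : e i₀ = ‖p‖⁻¹ • p := he i₀ rfl
  let O : Matrix n n ℝ := Matrix.of fun i j => e i j
  have hO : O * Oᵀ = 1 := by
    ext i j
    have := orthonormal_iff_ite.mp e.orthonormal i j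
    rw [PiLp.inner_apply] at this
    simp only [mul_apply, transpose_apply, O, of_apply, one_apply]
    rw [← this]
    simp [mul_comm]
  have hO' : Oᵀ * O = 1 := mul_eq_one_comm.mp hO
  refine ⟨Bᵀ * Oᵀ, ?_, ‖p‖, hr, ?_⟩
  · rw [transpose_mul, transpose_transpose, transpose_transpose, Matrix.mul_assoc,
      ← Matrix.mul_assoc Oᵀ, hO', Matrix.one_mul, hB]
  · rw [transpose_mul, transpose_transpose, transpose_transpose, ← mulVec_mulVec]
    have hp' : B *ᵥ b = ‖p‖ • (Oᵀ *ᵥ Pi.single i₀ 1) := by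
      ext k
      have : p k = ‖p‖ * (e i₀) k := by
        rw [he₀]; simp [hr.ne']
      simpa [O, p] using this
    rw [hp', mulVec_smul, mulVec_mulVec, hO, one_mulVec]
    ext k
    by_cases hk : k = i₀
    · subst hk; simp
    · simp [hk]

/-- The density of a product of unit-variance Gaussians. -/
lemma pi_gaussianReal_eq_withDensity {n : Type*} [Fintype n] (c : n → ℝ) :
    Measure.pi (fun i => gaussianReal (c i) 1) =
      volume.withDensity fun y => ENNReal.ofReal (∏ i, gaussianPDFReal (c i) 1 (y i)) := by
  refine Measure.pi_eq fun s hs => ?_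
  have hInt : Integrable (fun y : n → ℝ => ∏ i, gaussianPDFReal (c i) 1 (y i))
      (Measure.pi fun i => volume.restrict (s i)) :=
    Integrable.fintype_prod_dep fun i => (integrable_gaussianPDFReal _ _).restrict
  rw [withDensity_apply _ (MeasurableSet.univ_pi hs), volume_pi, Measure.restrict_pi_pi,
    ← ofReal_integral_eq_lintegral_ofReal hInt (ae_of_all _ fun y =>
      Finset.prod_nonneg fun i _ => gaussianPDFReal_nonneg _ _ _),
    integral_fintype_prod_eq_prod (fun i => gaussianPDFReal (c i) 1),
    ENNReal.ofReal_prod_of_nonneg fun i _ =>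
      integral_nonneg fun y => gaussianPDFReal_nonneg _ _ _]
  exact Finset.prod_congr rfl fun i _ => (gaussianReal_apply_eq_integral _ one_ne_zero _).symm

lemma gaussDensity_mulVec {d : ℕ} (A : Matrix (Fin d) (Fin d) ℝ) (hA : A.det ≠ 0)
    (c y : Fin d → ℝ) :
    gaussDensity (A *ᵥ c) (A * Aᵀ) (A *ᵥ y) =
      |A.det|⁻¹ * ∏ i, gaussianPDFReal (c i) 1 (y i) := by
  have hu : IsUnit A.det := isUnit_iff_ne_zero.mpr hA
  have hq : (A *ᵥ y - A *ᵥ c) ⬝ᵥ ((A * Aᵀ)⁻¹ *ᵥ (A *ᵥ y - A *ᵥ c)) = ∑ i, (y i - c i) ^ 2 := by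
    rw [← mulVec_sub, Matrix.mul_inv_rev, mulVec_mulVec, Matrix.mul_assoc,
      nonsing_inv_mul _ hu, Matrix.mul_one, ← transpose_nonsing_inv, dotProduct_mulVec,
      vecMul_transpose, mulVec_mulVec, nonsing_inv_mul _ hu, one_mulVec]
    simp [dotProduct, sq]
  have hdet : (A * Aᵀ).det ^ (-(1 : ℝ) / 2) = |A.det|⁻¹ := by
    rw [det_mul, det_transpose, ← sq, ← sq_abs, ← Real.rpow_natCast, ← Real.rpow_mul (abs_nonneg _)]
    norm_num
    exact Real.rpow_neg_one _
  have hpi : (2 * π) ^ (-(d : ℝ) / 2) = ∏ _i : Fin d, (√(2 * π))⁻¹ := by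
    rw [Finset.prod_const, Finset.card_univ, Fintype.card_fin, Real.sqrt_eq_rpow,
      ← Real.rpow_neg (by positivity), ← Real.rpow_natCast, ← Real.rpow_mul (by positivity)]
    congr 1; ring
  have hexp : Real.exp (-(1 / 2) * ∑ i, (y i - c i) ^ 2) =
      ∏ i, Real.exp (-(y i - c i) ^ 2 / (2 * (1 : NNReal))) := by
    rw [← Real.exp_sum, Finset.mul_sum]
    congr 1
    refine Finset.sum_congr rfl fun i _ => ?_
    simp; ring
  simp only [gaussDensity, gaussianPDFReal]
  rw [hq, hdet, hpi, hexp, Finset.prod_mul_distrib]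
  simp
  ring

lemma measurable_gaussDensity {d : ℕ} (μ : Fin d → ℝ) (S : Matrix (Fin d) (Fin d) ℝ) :
    Measurable (gaussDensity μ S) := by
  unfold gaussDensity
  refine Measurable.const_mul (Continuous.measurable ?_) _
  fun_prop

/-- A linear image of a product of unit-variance Gaussians has the Gaussian density. -/
lemma map_mulVec_pi_gaussianReal {d : ℕ} (A : Matrix (Fin d) (Fin d) ℝ) (hA : A.det ≠ 0)
    (c : Fin d → ℝ) :
    (Measure.pi fun i => gaussianReal (c i) 1).map (A *ᵥ ·) =
      volume.withDensity fun x => ENNReal.ofReal (gaussDensity (A *ᵥ c) (A * Aᵀ) x) := by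
  have hmeas : Measurable (A *ᵥ · : (Fin d → ℝ) → Fin d → ℝ) :=
    (Continuous.matrix_mulVec continuous_const continuous_id).measurable
  have hg : Measurable fun x => ENNReal.ofReal (gaussDensity (A *ᵥ c) (A * Aᵀ) x) :=
    (measurable_gaussDensity _ _).ennreal_ofReal
  have hpos : 0 < |A.det| := abs_pos.mpr hA
  have hvol : (volume : Measure (Fin d → ℝ)) =
      ENNReal.ofReal |A.det| • Measure.map (A *ᵥ ·) volume := by
    have h := Real.map_matrix_volume_pi_eq_smul_volume_pi hA
    have h' : Measure.map (A *ᵥ ·) (volume : Measure (Fin d → ℝ)) =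
      ENNReal.ofReal |A.det⁻¹| • volume := h
    rw [h', smul_smul, ← ENNReal.ofReal_mul hpos.le, abs_inv, mul_inv_cancel₀ hpos.ne']
    simp
  ext s hs
  rw [Measure.map_apply hmeas hs, pi_gaussianReal_eq_withDensity, withDensity_apply _ (hmeas hs),
    withDensity_apply _ hs]
  conv_rhs => rw [hvol]
  rw [Measure.restrict_smul, lintegral_smul_measure, setLIntegral_map hs hg hmeas, smul_eq_mul,
    ← lintegral_const_mul' _ _ ENNReal.ofReal_ne_top]
  refine lintegral_congr fun y => ?_
  rw [gaussDensity_mulVec A hA, ← ENNReal.ofReal_mul hpos.le, ← mul_assoc,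
    mul_inv_cancel₀ hpos.ne', one_mul]

lemma gaussDensity_neg {d : ℕ} (μ : Fin d → ℝ) (S : Matrix (Fin d) (Fin d) ℝ) (x : Fin d → ℝ) :
    gaussDensity (-μ) S x = gaussDensity μ S (-x) := by
  have : -x - μ = -(x - -μ) := by abel
  simp only [gaussDensity, this, mulVec_neg, neg_dotProduct_neg]

lemma gaussDensity_nonneg {d : ℕ} (μ : Fin d → ℝ) {S : Matrix (Fin d) (Fin d) ℝ}
    (hS : 0 ≤ S.det) (x : Fin d → ℝ) : 0 ≤ gaussDensity μ S x := by
  unfold gaussDensity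
  positivity

/-- The symmetric Gaussian mixture is the average of the laws of `A Y` and `-(A Y)`, where `Y`
has independent unit-variance Gaussian coordinates. -/
lemma symMix_eq_map {d : ℕ} (A : Matrix (Fin d) (Fin d) ℝ) (hA : A.det ≠ 0) (c : Fin d → ℝ) :
    symMix (A *ᵥ c) (A * Aᵀ) =
      (2⁻¹ : ℝ≥0∞) • (Measure.pi fun i => gaussianReal (c i) 1).map (A *ᵥ ·) +
      (2⁻¹ : ℝ≥0∞) • ((Measure.pi fun i => gaussianReal (c i) 1).map (A *ᵥ ·)).map (- ·) := by
  have hdet : 0 ≤ (A * Aᵀ).det := by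
    rw [det_mul, det_transpose]; exact mul_self_nonneg _
  have h2 : ENNReal.ofReal (1 / 2) = 2⁻¹ := by
    rw [one_div, ENNReal.ofReal_inv_of_pos two_pos]; simp
  have hm (m : Fin d → ℝ) : Measurable fun x => ENNReal.ofReal (gaussDensity m (A * Aᵀ) x) :=
    (measurable_gaussDensity _ _).ennreal_ofReal
  have hneg : (volume.withDensity fun x =>
        ENNReal.ofReal (gaussDensity (A *ᵥ c) (A * Aᵀ) x)).map (- ·) =
      volume.withDensity fun x => ENNReal.ofReal (gaussDensity (-(A *ᵥ c)) (A * Aᵀ) x) := by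
    ext s hs
    rw [Measure.map_apply measurable_neg hs, withDensity_apply _ (measurable_neg hs),
      withDensity_apply _ hs]
    conv_rhs => rw [← (Measure.measurePreserving_neg (volume : Measure (Fin d → ℝ))).map_eq]
    rw [setLIntegral_map hs (hm _) measurable_neg]
    simp_rw [gaussDensity_neg, neg_neg]
  rw [map_mulVec_pi_gaussianReal A hA, hneg, symMix, ← withDensity_smul _ (hm _),
    ← withDensity_smul _ (hm _), ← withDensity_add_left ((hm _).const_smul _)]
  congr 1
  ext x
  simp only [Pi.add_apply, Pi.smul_apply, smul_eq_mul]
  rw [ENNReal.ofReal_add, ENNReal.ofReal_mul (by norm_num), ENNReal.ofReal_mul (by norm_num), h2]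
  · exact mul_nonneg (by norm_num) (gaussDensity_nonneg _ hdet _)
  · exact mul_nonneg (by norm_num) (gaussDensity_nonneg _ hdet _)

/-- Even functions cannot distinguish the mixture from a single Gaussian component. -/
lemma integrable_comp_mulVec_and_integral_symMix {d : ℕ} (A : Matrix (Fin d) (Fin d) ℝ)
    (hA : A.det ≠ 0) (c : Fin d → ℝ) {g : (Fin d → ℝ) → ℝ} (hg : Measurable g)
    (heven : ∀ x, g (-x) = g x) (hInt : Integrable g (symMix (A *ᵥ c) (A * Aᵀ))) :
    Integrable (fun y => g (A *ᵥ y)) (Measure.pi fun i => gaussianReal (c i) 1) ∧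
      ∫ x, g x ∂(symMix (A *ᵥ c) (A * Aᵀ)) =
        ∫ y, g (A *ᵥ y) ∂(Measure.pi fun i => gaussianReal (c i) 1) := by
  have hmeas : Measurable (A *ᵥ · : (Fin d → ℝ) → Fin d → ℝ) :=
    (Continuous.matrix_mulVec continuous_const continuous_id).measurable
  rw [symMix_eq_map A hA c] at hInt ⊢
  obtain ⟨h₁, h₂⟩ := integrable_add_measure.mp hInt
  have h₁' := (integrable_smul_measure (by simp) (by simp)).mp h₁
  refine ⟨(integrable_map_measure hg.aestronglyMeasurable hmeas.aemeasurable).mp h₁', ?_⟩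
  rw [integral_add_measure h₁ h₂, integral_smul_measure, integral_smul_measure,
    integral_map measurable_neg.aemeasurable hg.aestronglyMeasurable]
  simp_rw [heven]
  rw [integral_map hmeas.aemeasurable hg.aestronglyMeasurable]
  simp
  ring

lemma eventually_integral_mul_exp_neg_mul_sq_neg {ψ : ℝ → ℝ} {r : ℝ} (hr : 0 < r)
    (hInt : ∀ a : ℝ, 0 < a → Integrable fun y => ψ y * Real.exp (-a * y ^ 2))
    (h₀ : ψ 0 ≤ 0) (hneg : ∀ y, y ≠ 0 → |y| < r → ψ y < 0) :
    ∀ᶠ a : ℝ in atTop, ∫ y, ψ y * Real.exp (-a * y ^ 2) < 0 := by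
  set W : ℝ → ℝ := fun y => ψ y * Real.exp (-1 * y ^ 2) with hW
  have hWint : Integrable W := hInt 1 one_pos
  have hle : ∀ y, |y| < r → ψ y ≤ 0 := fun y hy => by
    rcases eq_or_ne y 0 with rfl | h
    exacts [h₀, (hneg y h hy).le]
  set s : Set ℝ := Set.Ioo (-(r / 2)) (r / 2) with hs
  have hcore : 0 < ∫ y, s.indicator (fun y => -W y) y := by
    rw [integral_pos_iff_support_of_nonneg]
    · refine lt_of_lt_of_le ?_ (measure_mono (s := Set.Ioo 0 (r / 2)) fun y hy => ?_)
      · simp [hr]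
      · have hy' : y ∈ s := ⟨by linarith [hy.1], hy.2⟩
        have : ψ y < 0 := hneg y hy.1.ne' (by rw [abs_of_pos hy.1]; linarith [hy.2])
        simp [hy', hW, this.ne]
    · intro y
      refine Set.indicator_nonneg (fun y hy => ?_) y
      have : ψ y ≤ 0 := hle y (by rw [abs_lt]; constructor <;> linarith [hy.1, hy.2])
      have := mul_nonneg (neg_nonneg.mpr this) (Real.exp_pos (-1 * y ^ 2)).le
      simp only [hW]; linarith
    · exact hWint.neg.indicator measurableSet_Ioo
  have hlim : Tendsto (fun a : ℝ => Real.exp (r ^ 2 * (1 - 3 / 4 * a)) * ∫ y, |W y|) atTop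
      (nhds (0 * ∫ y, |W y|)) := by
    refine Tendsto.mul_const _ (Real.tendsto_exp_atBot.comp ?_)
    refine Tendsto.const_mul_atBot (by positivity) ?_
    refine tendsto_atBot_add_const_left _ 1 (f := fun a : ℝ => -(3 / 4 * a)) ?_
    exact tendsto_neg_atTop_atBot.comp (tendsto_id.const_mul_atTop (by norm_num))
  rw [zero_mul] at hlim
  filter_upwards [hlim.eventually_lt_const hcore, eventually_ge_atTop 1] with a ha ha1
  have hpt : ∀ y, ψ y * Real.exp (-a * y ^ 2) * Real.exp (a * (r / 2) ^ 2) ≤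
      -(s.indicator (fun y => -W y) y) + Real.exp (r ^ 2 * (1 - 3 / 4 * a)) * |W y| := by
    intro y
    have hnn : 0 ≤ Real.exp (r ^ 2 * (1 - 3 / 4 * a)) * |W y| := by positivity
    rw [mul_assoc, ← Real.exp_add]
    by_cases hy : y ∈ s
    · have hy2 : |y| < r / 2 := abs_lt.mpr hy
      have h1 : ψ y ≤ 0 := hle y (by linarith)
      have h2 : y ^ 2 ≤ (r / 2) ^ 2 := by
        rw [← sq_abs y]; exact pow_le_pow_left₀ (abs_nonneg _) hy2.le 2
      have h3 : Real.exp (-1 * y ^ 2) ≤ Real.exp (-a * y ^ 2 + a * (r / 2) ^ 2) := by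
        apply Real.exp_le_exp.mpr; nlinarith [sq_nonneg y]
      have := mul_le_mul_of_nonpos_left h3 h1
      simp only [Set.indicator_of_mem hy, neg_neg]
      linarith
    · simp only [Set.indicator_of_notMem hy, neg_zero, zero_add]
      by_cases hy3 : |y| < r
      · exact (mul_nonpos_of_nonpos_of_nonneg (hle y hy3) (Real.exp_pos _).le).trans hnn
      · have h2 : r ^ 2 ≤ y ^ 2 := by
          rw [← sq_abs y]; exact pow_le_pow_left₀ hr.le (not_lt.mp hy3) 2
        rw [hW, abs_mul, Real.abs_exp, mul_left_comm, ← Real.exp_add]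
        refine mul_le_mul (le_abs_self _) (Real.exp_le_exp.mpr ?_) (Real.exp_pos _).le
          (abs_nonneg _)
        nlinarith
  have hi1 : Integrable fun y => -(s.indicator (fun y => -W y) y) :=
    (hWint.neg.indicator measurableSet_Ioo).neg
  have hi2 : Integrable fun y => Real.exp (r ^ 2 * (1 - 3 / 4 * a)) * |W y| :=
    hWint.abs.const_mul _
  have hmono := integral_mono ((hInt a (by linarith)).mul_const _) (hi1.add hi2) hpt
  simp only [Pi.add_apply] at hmono
  rw [integral_add hi1 hi2, integral_neg, integral_const_mul, integral_mul_const] at hmono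
  have : (∫ y, ψ y * Real.exp (-a * y ^ 2)) * Real.exp (a * (r / 2) ^ 2) < 0 := by linarith
  exact neg_of_mul_neg_left this (Real.exp_pos _).le

lemma eventually_integral_mul_exp_neg_mul_sq_pos {ψ : ℝ → ℝ} {δ T : ℝ} (hδ : 0 < δ) (hT : 0 < T)
    (hInt : ∀ a : ℝ, 0 < a → Integrable fun y => ψ y * Real.exp (-a * y ^ 2))
    (hpos : ∀ y, T ≤ |y| → δ ≤ ψ y) :
    ∀ᶠ M : ℝ in atTop, 0 < ∫ y, ψ y * Real.exp (-(M ^ 2)⁻¹ * y ^ 2) := by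
  set s : Set ℝ := Set.Ioo (-T) T with hs
  set C : ℝ := Real.exp (T ^ 2) * ∫ y, |ψ y * Real.exp (-1 * y ^ 2)| with hC
  have hlim : Tendsto (fun M : ℝ => δ * Real.exp (-1) * (M - T)) atTop atTop :=
    Tendsto.const_mul_atTop (by positivity) (tendsto_atTop_add_const_right _ _ tendsto_id)
  filter_upwards [hlim.eventually_gt_atTop C, eventually_ge_atTop T] with M hM hMT
  have hM0 : 0 < M := hT.trans_le hMT
  have hpt : ∀ y, (Set.Icc T M).indicator (fun _ => δ * Real.exp (-1)) y -
      Real.exp (T ^ 2) * |ψ y * Real.exp (-1 * y ^ 2)| ≤ ψ y * Real.exp (-(M ^ 2)⁻¹ * y ^ 2) := by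
    intro y
    by_cases hy : |y| < T
    · have h1 : y ∉ Set.Icc T M := fun h => by
        have := le_abs_self y; linarith [h.1]
      rw [Set.indicator_of_notMem h1, abs_mul, Real.abs_exp, mul_left_comm, ← Real.exp_add,
        zero_sub]
      have h2 : y ^ 2 ≤ T ^ 2 := by
        rw [← sq_abs y]; exact pow_le_pow_left₀ (abs_nonneg _) hy.le 2
      have h3 : Real.exp (-(M ^ 2)⁻¹ * y ^ 2) ≤ Real.exp (T ^ 2 + -1 * y ^ 2) := by
        apply Real.exp_le_exp.mpr
        have : 0 ≤ (M ^ 2)⁻¹ * y ^ 2 := by positivity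
        linarith
      have h4 := mul_le_mul_of_nonneg_left h3 (abs_nonneg (ψ y))
      have h5 := mul_le_mul_of_nonneg_right (neg_abs_le (ψ y)) (Real.exp_pos (-(M ^ 2)⁻¹ * y ^ 2)).le
      linarith
    · have h1 := hpos y (not_lt.mp hy)
      have h2 : 0 ≤ Real.exp (T ^ 2) * |ψ y * Real.exp (-1 * y ^ 2)| := by positivity
      suffices (Set.Icc T M).indicator (fun _ => δ * Real.exp (-1)) y ≤
        ψ y * Real.exp (-(M ^ 2)⁻¹ * y ^ 2) by linarith
      refine Set.indicator_apply_le' (fun hy' => ?_) (fun _ => ?_)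
      · refine mul_le_mul h1 (Real.exp_le_exp.mpr ?_) (Real.exp_pos _).le (hδ.le.trans h1)
        have h3 : y ^ 2 ≤ M ^ 2 := pow_le_pow_left₀ (hT.le.trans hy'.1) hy'.2 2
        have : (M ^ 2)⁻¹ * y ^ 2 ≤ (M ^ 2)⁻¹ * M ^ 2 := by gcongr
        rw [inv_mul_cancel₀ (by positivity)] at this
        linarith
      · exact mul_nonneg (hδ.le.trans h1) (Real.exp_pos _).le
  have hi1 : Integrable ((Set.Icc T M).indicator fun _ : ℝ => δ * Real.exp (-1)) :=
    (integrable_indicator_iff measurableSet_Icc).mpr (integrableOn_const (by simp))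
  have hi2 := ((hInt 1 one_pos).abs.const_mul (Real.exp (T ^ 2)))
  have hmono := integral_mono (hi1.sub hi2) (hInt (M ^ 2)⁻¹ (by positivity)) hpt
  simp only [Pi.sub_apply] at hmono
  rw [integral_sub hi1 hi2, integral_indicator_const _ measurableSet_Icc, integral_const_mul,
    ← hC] at hmono
  simp only [measureReal_def, Real.volume_Icc, ENNReal.toReal_ofReal (sub_nonneg.mpr hMT),
    smul_eq_mul] at hmono
  linarith

/-- A function that changes sign from negative to positive has a zero where its derivative is
nonnegative. -/
lemma exists_eq_zero_and_deriv_nonneg {h h' : ℝ → ℝ} {a b : ℝ} (hab : a < b)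
    (hd : ∀ t ∈ Set.Icc a b, HasDerivAt h (h' t) t) (ha : h a < 0) (hb : 0 < h b) :
    ∃ t ∈ Set.Icc a b, h t = 0 ∧ 0 ≤ h' t := by
  have hcont : ContinuousOn h (Set.Icc a b) := fun t ht => (hd t ht).continuousAt.continuousWithinAt
  set Z : Set ℝ := Set.Icc a b ∩ h ⁻¹' Set.Iic 0 with hZ
  have hZc : IsCompact Z :=
    isCompact_Icc.of_isClosed_subset (hcont.preimage_isClosed_of_isClosed isClosed_Icc isClosed_Iic)
      Set.inter_subset_left
  obtain ⟨t, ht, hmax⟩ := hZc.exists_isGreatest ⟨a, ⟨le_rfl, hab.le⟩, ha.le⟩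
  have htb : t < b := lt_of_le_of_ne ht.1.2 (by rintro rfl; exact absurd hb (not_lt.mpr ht.2))
  have hright : ∀ u ∈ Set.Ioo t b, 0 < h u := fun u hu => by
    by_contra hcon
    exact absurd (hmax ⟨⟨ht.1.1.trans hu.1.le, hu.2.le⟩, not_lt.mp hcon⟩) (not_le.mpr hu.1)
  have hev : ∀ᶠ u in nhdsWithin t (Set.Ioi t), u ∈ Set.Ioo t b := Ioo_mem_nhdsGT htb
  have hnn : 0 ≤ h t :=
    ge_of_tendsto ((hd t ht.1).continuousAt.tendsto.mono_left nhdsWithin_le_nhds)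
      (hev.mono fun u hu => (hright u hu).le)
  have h0 : h t = 0 := le_antisymm ht.2 hnn
  refine ⟨t, ht.1, h0, ?_⟩
  have hs := (hasDerivAt_iff_tendsto_slope.mp (hd t ht.1)).mono_left
    (nhdsWithin_mono t (show Set.Ioi t ⊆ {t}ᶜ from fun u hu => ne_of_gt hu))
  refine ge_of_tendsto hs (hev.mono fun u hu => ?_)
  rw [slope_def_field, h0, sub_zero]
  exact div_nonneg (hright u hu).le (sub_pos.mpr hu.1).le

lemma gaussianPDFReal_zero_one (y : ℝ) :
    gaussianPDFReal 0 1 y = (√(2 * π))⁻¹ * Real.exp (-(2 : ℝ)⁻¹ * y ^ 2) := by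
  simp only [gaussianPDFReal, NNReal.coe_one, mul_one, sub_zero]
  congr 2; ring

lemma integrable_gaussianReal_zero_one_iff {h : ℝ → ℝ} :
    Integrable h (gaussianReal 0 1) ↔
      Integrable fun y => h y * Real.exp (-(2 : ℝ)⁻¹ * y ^ 2) := by
  have hc : IsUnit (√(2 * π))⁻¹ := isUnit_iff_ne_zero.mpr (by positivity)
  rw [gaussianReal_of_var_ne_zero 0 one_ne_zero, integrable_withDensity_iff_integrable_smul'
    (measurable_gaussianPDF _ _) (ae_of_all _ fun _ => gaussianPDF_lt_top),
    ← integrable_const_mul_iff hc fun y => h y * Real.exp (-(2 : ℝ)⁻¹ * y ^ 2)]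
  refine integrable_congr (ae_of_all _ fun y => ?_)
  simp only [toReal_gaussianPDF, smul_eq_mul, gaussianPDFReal_zero_one]
  ring

lemma integral_gaussianReal_zero_one (h : ℝ → ℝ) :
    ∫ y, h y ∂gaussianReal 0 1 =
      (√(2 * π))⁻¹ * ∫ y, h y * Real.exp (-(2 : ℝ)⁻¹ * y ^ 2) := by
  rw [integral_gaussianReal_eq_integral_smul one_ne_zero, ← integral_const_mul]
  refine integral_congr_ae (ae_of_all _ fun y => ?_)
  simp only [smul_eq_mul, gaussianPDFReal_zero_one]
  ring

lemma integrable_comp_mul_gaussianReal_iff {g : ℝ → ℝ} {s : ℝ} (hs : 0 < s) :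
    Integrable (fun y => g (s * y)) (gaussianReal 0 1) ↔
      Integrable fun y => g y * Real.exp (-(2 * s ^ 2)⁻¹ * y ^ 2) := by
  rw [integrable_gaussianReal_zero_one_iff,
    ← integrable_comp_mul_left_iff (fun y => g y * Real.exp (-(2 * s ^ 2)⁻¹ * y ^ 2)) hs.ne']
  refine integrable_congr (ae_of_all _ fun y => ?_)
  simp only
  congr 2
  field_simp

lemma integral_comp_mul_gaussianReal (g : ℝ → ℝ) {s : ℝ} (hs : 0 < s) :
    ∫ y, g (s * y) ∂gaussianReal 0 1 =
      (√(2 * π))⁻¹ * s⁻¹ * ∫ y, g y * Real.exp (-(2 * s ^ 2)⁻¹ * y ^ 2) := by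
  have h := Measure.integral_comp_mul_left (fun y => g y * Real.exp (-(2 * s ^ 2)⁻¹ * y ^ 2)) s
  rw [abs_of_pos (inv_pos.mpr hs), smul_eq_mul] at h
  rw [integral_gaussianReal_zero_one, mul_assoc, ← h]
  congr 1
  refine integral_congr_ae (ae_of_all _ fun y => ?_)
  simp only
  congr 2
  field_simp

/-- Cameron–Martin formula for the standard Gaussian on the line. -/
lemma integral_comp_mul_add_gaussianReal (g : ℝ → ℝ) {s : ℝ} (hs : 0 < s) (e : ℝ) :
    ∫ y, g (s * y + e) ∂gaussianReal 0 1 =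
      ∫ y, g (s * y) * Real.exp (e * y / s - e ^ 2 / (2 * s ^ 2)) ∂gaussianReal 0 1 := by
  rw [integral_gaussianReal_zero_one, integral_gaussianReal_zero_one,
    ← integral_sub_right_eq_self _ (e / s)]
  congr 1
  refine integral_congr_ae (ae_of_all _ fun y => ?_)
  simp only
  rw [mul_assoc, ← Real.exp_add]
  congr 2 <;> field_simp <;> ring

lemma integral_sq_gaussianReal_one (c : ℝ) : ∫ y, y ^ 2 ∂gaussianReal c 1 = c ^ 2 + 1 := by
  have h := variance_eq_sub (memLp_id_gaussianReal (μ := c) (v := 1) 2)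
  simp only [variance_id_gaussianReal, id_eq, Pi.pow_apply, integral_id_gaussianReal,
    NNReal.coe_one] at h
  linarith

lemma integrable_exp_sq_div_four_gaussianReal (c : ℝ) :
    Integrable (fun y => Real.exp (y ^ 2 / 4)) (gaussianReal c 1) := by
  rw [gaussianReal_of_var_ne_zero c one_ne_zero, integrable_withDensity_iff_integrable_smul'
    (measurable_gaussianPDF _ _) (ae_of_all _ fun _ => gaussianPDF_lt_top)]
  refine Integrable.mono' ((integrable_exp_neg_mul_sq (b := 1 / 8) (by norm_num)).const_mul
    ((√(2 * π))⁻¹ * Real.exp (2 * c ^ 2))) ?_ (ae_of_all _ fun y => ?_)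
  · simp only [toReal_gaussianPDF]
    exact ((measurable_gaussianPDFReal _ _).smul (by fun_prop)).aestronglyMeasurable
  · simp only [toReal_gaussianPDF, gaussianPDFReal, NNReal.coe_one, mul_one, smul_eq_mul]
    rw [Real.norm_of_nonneg (by positivity), mul_assoc, mul_assoc, ← Real.exp_add, ← Real.exp_add]
    refine mul_le_mul_of_nonneg_left (Real.exp_le_exp.mpr ?_) (by positivity)
    nlinarith [sq_nonneg (y - 4 * c)]

lemma integrable_comp_mul_mul_exp_sq_div_four {g : ℝ → ℝ} {s : ℝ} (hs : 0 < s)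
    (h : Integrable (fun y => g (√2 * s * y)) (gaussianReal 0 1)) :
    Integrable (fun y => g (s * y) * Real.exp (y ^ 2 / 4)) (gaussianReal 0 1) := by
  rw [integrable_comp_mul_gaussianReal_iff (by positivity), mul_pow,
    Real.sq_sqrt zero_le_two] at h
  rw [integrable_gaussianReal_zero_one_iff]
  refine ((integrable_comp_mul_left_iff _ hs.ne').mpr h).congr (ae_of_all _ fun y => ?_)
  simp only
  rw [mul_assoc, ← Real.exp_add]
  congr 2
  field_simp
  ring

lemma abs_le_four_mul_exp (x : ℝ) : |x| ≤ 4 * Real.exp (x ^ 2 / 32) := by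
  have h := Real.add_one_le_exp (x ^ 2 / 32)
  nlinarith [sq_nonneg (|x| - 4), sq_abs x, abs_nonneg x]

/-- Differentiating a Gaussian integral along a shear. -/
lemma hasDerivAt_integral_shear {g : ℝ → ℝ} (hg : Measurable g) {s : ℝ} (hs : 0 < s) (c : ℝ)
    (hInt : ∀ ε : ℝ, Integrable (fun p : ℝ × ℝ => p.2 * g (s * p.1 + ε * p.2))
      ((gaussianReal 0 1).prod (gaussianReal c 1)))
    (hexp : Integrable (fun y => g (s * y) * Real.exp (y ^ 2 / 4)) (gaussianReal 0 1)) :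
    HasDerivAt (fun ε : ℝ => ∫ p : ℝ × ℝ, p.2 * g (s * p.1 + ε * p.2)
        ∂((gaussianReal 0 1).prod (gaussianReal c 1)))
      ((c ^ 2 + 1) / s * ∫ y, y * g (s * y) ∂gaussianReal 0 1) 0 := by
  set P := (gaussianReal 0 1).prod (gaussianReal c 1) with hP
  let E : ℝ → ℝ × ℝ → ℝ := fun ε p =>
    Real.exp (ε * p.2 * p.1 / s - (ε * p.2) ^ 2 / (2 * s ^ 2))
  let G : ℝ → ℝ × ℝ → ℝ := fun ε p => p.2 * (g (s * p.1) * E ε p)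
  let G' : ℝ → ℝ × ℝ → ℝ := fun ε p =>
    p.2 * (g (s * p.1) * (E ε p * (p.2 * p.1 / s - ε * p.2 ^ 2 / s ^ 2)))
  let B : ℝ × ℝ → ℝ := fun p =>
    |g (s * p.1) * Real.exp (p.1 ^ 2 / 4)| * Real.exp (p.2 ^ 2 / 4)
  have hB : Integrable B P := hexp.abs.mul_prod (integrable_exp_sq_div_four_gaussianReal c)
  have hgm : Measurable fun p : ℝ × ℝ => g (s * p.1) := hg.comp (by fun_prop)
  have hGm (ε : ℝ) : Measurable (G ε) :=
    measurable_snd.mul (hgm.mul (Continuous.measurable (by fun_prop)))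
  have hGm' (ε : ℝ) : Measurable (G' ε) :=
    measurable_snd.mul (hgm.mul (Continuous.measurable (by fun_prop)))
  have hexp8 (x : ℝ) : Real.exp (x ^ 2 / 4) = Real.exp (x ^ 2 / 32) ^ 8 := by
    rw [← Real.exp_nat_mul]; congr 1; push_cast; ring
  have hE (ε : ℝ) (hε : |ε| < s / 4) (p : ℝ × ℝ) :
      E ε p ≤ Real.exp (p.1 ^ 2 / 32) ^ 4 * Real.exp (p.2 ^ 2 / 32) ^ 4 := by
    rw [← Real.exp_nat_mul, ← Real.exp_nat_mul, ← Real.exp_add]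
    refine Real.exp_le_exp.mpr ?_
    have h1 : |ε / s| ≤ 1 / 4 := by
      rw [abs_div, abs_of_pos hs, div_le_iff₀ hs]; linarith
    have h2 : ε * p.2 * p.1 / s = ε / s * (p.2 * p.1) := by ring
    have h3 : ε / s * (p.2 * p.1) ≤ 1 / 4 * |p.2 * p.1| := by
      refine (le_abs_self _).trans ?_
      rw [abs_mul]; gcongr
    have h4 : |p.2 * p.1| ≤ (p.1 ^ 2 + p.2 ^ 2) / 2 := by
      rw [abs_le]; constructor <;> nlinarith [sq_nonneg (p.1 - p.2), sq_nonneg (p.1 + p.2)]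
    have h5 : 0 ≤ (ε * p.2) ^ 2 / (2 * s ^ 2) := by positivity
    push_cast
    linarith
  have hGB (ε : ℝ) (hε : |ε| < s / 4) (p : ℝ × ℝ) : ‖G ε p‖ ≤ 4 * B p := by
    have hE' := hE ε hε p
    have hq := abs_le_four_mul_exp p.2
    simp only [G, B, Real.norm_eq_abs, abs_mul, abs_pow, Real.abs_exp, E, hexp8]
    set u := Real.exp (p.1 ^ 2 / 32)
    set v := Real.exp (p.2 ^ 2 / 32)
    have hu : 1 ≤ u := Real.one_le_exp (by positivity)
    have hv : 1 ≤ v := Real.one_le_exp (by positivity)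
    calc _ ≤ (4 * v) * (|g (s * p.1)| * (u ^ 4 * v ^ 4)) := by gcongr
      _ = 4 * (|g (s * p.1)| * u ^ 4 * v ^ 5) := by ring
      _ ≤ _ := by gcongr <;> norm_num
  have hGB' (ε : ℝ) (hε : |ε| < s / 4) (p : ℝ × ℝ) : ‖G' ε p‖ ≤ 80 / s * B p := by
    have hE' := hE ε hε p
    have hq := abs_le_four_mul_exp p.2
    have hq' := abs_le_four_mul_exp p.1
    have hsum : |p.2 * p.1 / s - ε * p.2 ^ 2 / s ^ 2| ≤
        |p.2| * |p.1| / s + |p.2| ^ 2 / (4 * s) := by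
      refine (abs_sub _ _).trans (add_le_add ?_ ?_)
      · rw [abs_div, abs_mul, abs_of_pos hs]
      · rw [abs_div, abs_mul, abs_pow, abs_pow, abs_of_pos hs]
        calc _ ≤ s / 4 * |p.2| ^ 2 / s ^ 2 := by gcongr
          _ = _ := by field_simp
    simp only [G', B, Real.norm_eq_abs, abs_mul, abs_pow, Real.abs_exp, E, hexp8]
    set u := Real.exp (p.1 ^ 2 / 32)
    set v := Real.exp (p.2 ^ 2 / 32)
    have hu : 1 ≤ u := Real.one_le_exp (by positivity)
    have hv : 1 ≤ v := Real.one_le_exp (by positivity)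
    calc _ ≤ (4 * v) * (|g (s * p.1)| * (u ^ 4 * v ^ 4 *
          ((4 * v) * (4 * u) / s + (4 * v) ^ 2 / (4 * s)))) := by
          gcongr
          refine hsum.trans ?_
          gcongr
      _ = |g (s * p.1)| * (64 / s * (u ^ 5 * v ^ 6) + 16 / s * (u ^ 4 * v ^ 7)) := by
          field_simp; ring
      _ ≤ |g (s * p.1)| * (64 / s * (u ^ 8 * v ^ 8) + 16 / s * (u ^ 8 * v ^ 8)) := by
          gcongr <;> norm_num
      _ = _ := by ring
  have hGi (ε : ℝ) (hε : |ε| < s / 4) : Integrable (G ε) P :=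
    (hB.const_mul 4).mono' (hGm ε).aestronglyMeasurable (ae_of_all _ (hGB ε hε))
  have hball : Metric.ball (0 : ℝ) (s / 4) ∈ nhds 0 := Metric.ball_mem_nhds _ (by positivity)
  have habs {ε : ℝ} (hε : ε ∈ Metric.ball (0 : ℝ) (s / 4)) : |ε| < s / 4 := by simpa using hε
  have heq : (fun ε : ℝ => ∫ p : ℝ × ℝ, p.2 * g (s * p.1 + ε * p.2) ∂P) =ᶠ[nhds 0]
      fun ε => ∫ p, G ε p ∂P := by
    filter_upwards [hball] with ε hε
    rw [hP, integral_prod_symm _ (hInt ε), integral_prod_symm _ (hGi ε (habs hε))]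
    refine integral_congr_ae (ae_of_all _ fun u => ?_)
    simp only [G, E]
    rw [integral_const_mul, integral_const_mul, integral_comp_mul_add_gaussianReal g hs]
  have hder := (hasDerivAt_integral_of_dominated_loc_of_deriv_le (μ := P) (F := G) (F' := G')
    (x₀ := 0) (bound := fun p => 80 / s * B p) hball
    (Eventually.of_forall fun ε => (hGm ε).aestronglyMeasurable) (hGi 0 (by simpa using hs))
    (hGm' 0).aestronglyMeasurable (ae_of_all _ fun p ε hε => hGB' ε (habs hε) p)
    (hB.const_mul _) (ae_of_all _ fun p ε _ => ?_)).2
  · have hval : ∫ p, G' 0 p ∂P = (c ^ 2 + 1) / s * ∫ y, y * g (s * y) ∂gaussianReal 0 1 := by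
      have : ∀ p : ℝ × ℝ, G' 0 p = s⁻¹ * ((p.1 * g (s * p.1)) * p.2 ^ 2) := fun p => by
        simp only [G', E]; simp; ring
      simp_rw [this]
      rw [integral_const_mul, hP, integral_prod_mul (fun y => y * g (s * y)) (fun y => y ^ 2),
        integral_sq_gaussianReal_one]
      ring
    rw [hval] at hder
    exact hder.congr_of_eventuallyEq heq
  · have h1 : HasDerivAt (fun ε : ℝ => ε * p.2 * p.1 / s - (ε * p.2) ^ 2 / (2 * s ^ 2))
        (p.2 * p.1 / s - ε * p.2 ^ 2 / s ^ 2) ε := by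
      have h2 := (((hasDerivAt_id ε).mul_const p.2).mul_const p.1).div_const s
      have h3 := (((hasDerivAt_id ε).mul_const p.2).pow 2).div_const (2 * s ^ 2)
      refine (h2.sub h3).congr_deriv ?_
      simp
      field_simp
    exact ((h1.exp.const_mul _).const_mul _)

/-- If `φ` is odd, negative just to the right of `0` and bounded below by a positive constant near
`+∞`, then `t ↦ E[y φ(t y)]` (with `y` standard Gaussian) has a zero with nonnegative derivative. -/
lemma exists_pos_integral_mul_comp_mul_eq_zero {φ φ' : ℝ → ℝ} (hodd : ∀ t, φ (-t) = -φ t)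
    (hneg : ∀ᶠ t in nhdsWithin 0 (Set.Ioi 0), φ t < 0)
    (hpos : ∃ ε : ℝ, 0 < ε ∧ ∀ᶠ t : ℝ in atTop, ε ≤ φ t)
    (hInt : ∀ t, 0 < t → Integrable (fun y => y * φ (t * y)) (gaussianReal 0 1))
    (hder : ∀ t, 0 < t → HasDerivAt (fun t => ∫ y, y * φ (t * y) ∂gaussianReal 0 1)
      (∫ y, y ^ 2 * φ' (t * y) ∂gaussianReal 0 1) t) :
    ∃ t, 0 < t ∧ ∫ y, y * φ (t * y) ∂gaussianReal 0 1 = 0 ∧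
      0 ≤ ∫ y, y ^ 2 * φ' (t * y) ∂gaussianReal 0 1 := by
  set ψ : ℝ → ℝ := fun y => y * φ y with hψ
  have hψabs (y : ℝ) : ψ y = |y| * φ |y| := by
    rcases abs_cases y with ⟨h, _⟩ | ⟨h, _⟩ <;> rw [h]
    simp [hψ, hodd]
  have hscale (t : ℝ) (ht : 0 < t) (y : ℝ) : y * φ (t * y) = t⁻¹ * ψ (t * y) := by
    simp only [hψ]; field_simp
  have hval (t : ℝ) (ht : 0 < t) : ∫ y, y * φ (t * y) ∂gaussianReal 0 1 =
      t⁻¹ * ((√(2 * π))⁻¹ * t⁻¹ * ∫ y, ψ y * Real.exp (-(2 * t ^ 2)⁻¹ * y ^ 2)) := by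
    simp_rw [hscale t ht]
    rw [integral_const_mul, integral_comp_mul_gaussianReal ψ ht]
  have hψint (a : ℝ) (ha : 0 < a) : Integrable fun y => ψ y * Real.exp (-a * y ^ 2) := by
    have ht : 0 < √((2 * a)⁻¹) := Real.sqrt_pos.mpr (by positivity)
    have h : Integrable (fun y => ψ (√((2 * a)⁻¹) * y)) (gaussianReal 0 1) := by
      refine ((hInt _ ht).const_mul (√((2 * a)⁻¹))).congr (ae_of_all _ fun y => ?_)
      simp only [hψ]; ring
    rw [integrable_comp_mul_gaussianReal_iff ht, Real.sq_sqrt (by positivity)] at h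
    have ha' : (2 * (2 * a)⁻¹)⁻¹ = a := by field_simp
    rwa [ha'] at h
  obtain ⟨ρ, hρ, hρneg⟩ := mem_nhdsGT_iff_exists_Ioo_subset.mp hneg
  obtain ⟨δ, hδ, hlarge⟩ := hpos
  obtain ⟨T, hT⟩ := eventually_atTop.mp hlarge
  have hT1 (y : ℝ) (hy : max T 1 ≤ |y|) : δ ≤ ψ y := by
    rw [hψabs]
    nlinarith [hT |y| ((le_max_left _ _).trans hy), (le_max_right T 1).trans hy]
  obtain ⟨a, ha, ha1⟩ := ((eventually_integral_mul_exp_neg_mul_sq_neg (ψ := ψ) hρ hψint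
    (by simp [hψ]) fun y hy0 hy => by
      rw [hψabs]
      exact mul_neg_of_pos_of_neg (abs_pos.mpr hy0) (hρneg ⟨abs_pos.mpr hy0, hy⟩)).and
    (eventually_ge_atTop 1)).exists
  obtain ⟨M, hM, hM2⟩ := ((eventually_integral_mul_exp_neg_mul_sq_pos (ψ := ψ) hδ
    (lt_max_of_lt_right one_pos) hψint hT1).and (eventually_ge_atTop 2)).exists
  have ha0 : 0 < a := by linarith
  have ht₁ : 0 < √((2 * a)⁻¹) := Real.sqrt_pos.mpr (by positivity)
  have ht₂ : 0 < M / √2 := by positivity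
  have hlt : √((2 * a)⁻¹) < M / √2 := by
    have h1 : √((2 * a)⁻¹) ≤ 1 := Real.sqrt_le_one.mpr (inv_le_one_of_one_le₀ (by linarith))
    have h2 : 1 < M / √2 := by
      rw [one_lt_div (by positivity)]
      have := Real.sq_sqrt (zero_le_two (α := ℝ))
      nlinarith [Real.sqrt_nonneg 2]
    linarith
  have h₁ : ∫ y, y * φ (√((2 * a)⁻¹) * y) ∂gaussianReal 0 1 < 0 := by
    rw [hval _ ht₁, Real.sq_sqrt (by positivity), show (2 * (2 * a)⁻¹)⁻¹ = a by field_simp]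
    exact mul_neg_of_pos_of_neg (by positivity) (mul_neg_of_pos_of_neg (by positivity) ha)
  have h₂ : 0 < ∫ y, y * φ (M / √2 * y) ∂gaussianReal 0 1 := by
    rw [hval _ ht₂, div_pow, Real.sq_sqrt zero_le_two, show 2 * (M ^ 2 / 2) = M ^ 2 by ring]
    positivity
  obtain ⟨t, ht, h0, h0'⟩ := exists_eq_zero_and_deriv_nonneg hlt
    (fun t ht => hder t (ht₁.trans_le ht.1)) h₁ h₂
  exact ⟨t, ht₁.trans_le ht.1, h0, h0'⟩

lemma integral_gaussianReal_zero_one_eq_zero_of_odd {h : ℝ → ℝ} (hh : ∀ y, h (-y) = -h y) :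
    ∫ y, h y ∂gaussianReal 0 1 = 0 := by
  rw [integral_gaussianReal_zero_one]
  have := integral_neg_eq_self (fun y => h y * Real.exp (-(2 : ℝ)⁻¹ * y ^ 2)) volume
  simp only [hh, neg_sq, neg_mul, integral_neg] at this ⊢
  rw [show ∫ y, h y * Real.exp (-((2 : ℝ)⁻¹ * y ^ 2)) = 0 by linarith, mul_zero]

section ProductGaussian

variable {ι : Type*} [Fintype ι] (c : ι → ℝ)

lemma iIndepFun_eval_pi_gaussianReal :
    iIndepFun (fun (i : ι) (y : ι → ℝ) => y i) (Measure.pi fun i => gaussianReal (c i) 1) :=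
  iIndepFun_pi (X := fun _ x => x) fun _ => aemeasurable_id

lemma integral_comp_eval_pi_gaussianReal (i : ι) {h : ℝ → ℝ} (hh : Measurable h) :
    ∫ y, h (y i) ∂(Measure.pi fun i => gaussianReal (c i) 1) = ∫ x, h x ∂gaussianReal (c i) 1 := by
  have hp := measurePreserving_eval (fun i => gaussianReal (c i) 1) i
  rw [← hp.map_eq, integral_map (measurable_pi_apply i).aemeasurable hh.aestronglyMeasurable]

lemma measurePreserving_pair_pi_gaussianReal {i j : ι} (hij : i ≠ j) :
    MeasurePreserving (fun y : ι → ℝ => (y i, y j)) (Measure.pi fun i => gaussianReal (c i) 1)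
      ((gaussianReal (c i) 1).prod (gaussianReal (c j) 1)) := by
  refine ⟨by fun_prop, ?_⟩
  have h := (indepFun_iff_map_prod_eq_prod_map_map
    (measurable_pi_apply i).aemeasurable (measurable_pi_apply j).aemeasurable).mp
    ((iIndepFun_eval_pi_gaussianReal c).indepFun hij)
  rw [h]
  congr 1
  exacts [(measurePreserving_eval (fun i => gaussianReal (c i) 1) i).map_eq,
    (measurePreserving_eval (fun i => gaussianReal (c i) 1) j).map_eq]

lemma integral_mul_comp_eval_pi_gaussianReal {i j k : ι} (hik : i ≠ k) (hjk : j ≠ k)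
    {F : ℝ × ℝ → ℝ} (hF : Measurable F) {h : ℝ → ℝ} (hh : Measurable h) :
    ∫ y, F (y i, y j) * h (y k) ∂(Measure.pi fun i => gaussianReal (c i) 1) =
      (∫ y, F (y i, y j) ∂(Measure.pi fun i => gaussianReal (c i) 1)) *
        ∫ x, h x ∂gaussianReal (c k) 1 := by
  have hind := ((iIndepFun_eval_pi_gaussianReal c).indepFun_prodMk
    (fun i => measurable_pi_apply i) i j k hik hjk).comp hF hh
  rw [← integral_comp_eval_pi_gaussianReal c k hh]
  exact hind.integral_fun_mul_eq_mul_integral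
    (hF.comp (by fun_prop)).aestronglyMeasurable (hh.comp (by fun_prop)).aestronglyMeasurable

variable [DecidableEq ι]

/-- The second derivative has mean zero along the critical direction, provided some coordinate is
independent of it. -/
lemma integral_comp_mul_gaussianReal_eq_zero {i₀ i : ι} (hi : i ≠ i₀) (hc : c i₀ = 0)
    {φ φ' : ℝ → ℝ} (hφ : Measurable φ) (hφ' : Measurable φ')
    (hInt : ∀ p q : ι → ℝ, Integrable (fun y => (p ⬝ᵥ y) * φ (q ⬝ᵥ y))
      (Measure.pi fun i => gaussianReal (c i) 1))
    (hder : ∀ (b w v : ι → ℝ) (t : ℝ), b + t • w ≠ 0 →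
      HasDerivAt (fun t => ∫ y, (v ⬝ᵥ y) * φ ((b + t • w) ⬝ᵥ y)
          ∂(Measure.pi fun i => gaussianReal (c i) 1))
        (∫ y, (v ⬝ᵥ y) * (w ⬝ᵥ y) * φ' ((b + t • w) ⬝ᵥ y)
          ∂(Measure.pi fun i => gaussianReal (c i) 1)) t)
    {s : ℝ} (hs : 0 < s) (hcrit : ∫ y, y * φ (s * y) ∂gaussianReal 0 1 = 0) :
    ∫ y, φ' (s * y) ∂gaussianReal 0 1 = 0 := by
  have hmp := measurePreserving_pair_pi_gaussianReal c hi.symm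
  rw [hc] at hmp
  have hFm (s ε : ℝ) : Measurable fun p : ℝ × ℝ => p.2 * φ (s * p.1 + ε * p.2) :=
    measurable_snd.mul (hφ.comp (by fun_prop))
  have hprod (s ε : ℝ) : Integrable (fun p : ℝ × ℝ => p.2 * φ (s * p.1 + ε * p.2))
      ((gaussianReal 0 1).prod (gaussianReal (c i) 1)) := by
    rw [← hmp.integrable_comp (hFm s ε).aestronglyMeasurable]
    refine (hInt (Pi.single i 1) (Pi.single i₀ s + Pi.single i ε)).congr (ae_of_all _ fun y => ?_)
    simp [add_dotProduct]
  have hexp : Integrable (fun y => φ (s * y) * Real.exp (y ^ 2 / 4)) (gaussianReal 0 1) := by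
    refine integrable_comp_mul_mul_exp_sq_div_four hs ?_
    have := nullSingletonClass_gaussianReal (μ := c i) one_ne_zero
    have hne : ∀ᵐ u ∂gaussianReal (c i) 1, u ≠ 0 := by
      simp [ae_iff]
    obtain ⟨u, hu, hu0⟩ := ((hprod (√2 * s) 0).prod_left_ae.and hne).exists
    simp only [zero_mul, add_zero] at hu
    exact (integrable_const_mul_iff (isUnit_iff_ne_zero.mpr hu0) _).mp hu
  have hshear := hasDerivAt_integral_shear hφ hs (c i) (hprod s) hexp
  rw [hcrit, mul_zero] at hshear
  have hs₀ : (Pi.single i₀ s : ι → ℝ) ≠ 0 := by simpa using hs.ne'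
  have hd := hder (Pi.single i₀ s) (Pi.single i 1) (Pi.single i 1) 0 (by simpa using hs₀)
  have hfun : (fun ε : ℝ => ∫ p : ℝ × ℝ, p.2 * φ (s * p.1 + ε * p.2)
        ∂((gaussianReal 0 1).prod (gaussianReal (c i) 1))) =
      fun t => ∫ y, (Pi.single i 1 ⬝ᵥ y) * φ ((Pi.single i₀ s + t • Pi.single i 1) ⬝ᵥ y)
          ∂(Measure.pi fun i => gaussianReal (c i) 1) := by
    ext ε
    rw [← hmp.map_eq, integral_map hmp.measurable.aemeasurable (hFm s ε).aestronglyMeasurable]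
    simp [add_dotProduct, smul_dotProduct]
  rw [hfun] at hshear
  have h0 := hd.unique hshear
  have hsq := integral_mul_comp_eval_pi_gaussianReal c hi hi (F := fun p => p.1 * p.2)
    (h := fun x => φ' (s * x)) (by fun_prop) (hφ'.comp (by fun_prop))
  have hsq' : ∫ y, y i * y i ∂(Measure.pi fun i => gaussianReal (c i) 1) = c i ^ 2 + 1 := by
    rw [← integral_sq_gaussianReal_one,
      ← integral_comp_eval_pi_gaussianReal c i (h := fun x => x ^ 2) (by fun_prop)]
    simp_rw [sq]
  simp only [zero_smul, add_zero, single_dotProduct, one_mul] at h0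
  rw [h0, hsq', hc] at hsq
  exact (mul_eq_zero.mp hsq.symm).resolve_left (by positivity)

/-- Existence of a spurious critical point in coordinates where the Gaussian has independent
unit-variance entries. -/
lemma exists_spurious_critical_point_pi_gaussianReal {i₀ : ι} (hc : c i₀ = 0)
    {φ φ' : ℝ → ℝ} (hφ : Measurable φ) (hφ' : Measurable φ')
    (hodd : ∀ t, φ (-t) = -φ t) (heven : ∀ t, φ' (-t) = φ' t)
    (hneg : ∀ᶠ t in nhdsWithin 0 (Set.Ioi 0), φ t < 0)
    (hpos : ∃ ε : ℝ, 0 < ε ∧ ∀ᶠ t : ℝ in atTop, ε ≤ φ t)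
    (hInt : ∀ p q : ι → ℝ, Integrable (fun y => (p ⬝ᵥ y) * φ (q ⬝ᵥ y))
      (Measure.pi fun i => gaussianReal (c i) 1))
    (hder : ∀ (b w v : ι → ℝ) (t : ℝ), b + t • w ≠ 0 →
      HasDerivAt (fun t => ∫ y, (v ⬝ᵥ y) * φ ((b + t • w) ⬝ᵥ y)
          ∂(Measure.pi fun i => gaussianReal (c i) 1))
        (∫ y, (v ⬝ᵥ y) * (w ⬝ᵥ y) * φ' ((b + t • w) ⬝ᵥ y)
          ∂(Measure.pi fun i => gaussianReal (c i) 1)) t) :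
    ∃ s, 0 < s ∧
      (∀ i, ∫ y, y i * φ (s * y i₀) ∂(Measure.pi fun i => gaussianReal (c i) 1) = 0) ∧
      ∃ a, 0 ≤ a ∧ ∀ i j,
        ∫ y, y i * y j * φ' (s * y i₀) ∂(Measure.pi fun i => gaussianReal (c i) 1) =
          if i = i₀ ∧ j = i₀ then a else 0 := by
  have hm (s : ℝ) : Measurable fun x => φ (s * x) := hφ.comp (by fun_prop)
  have hm' (s : ℝ) : Measurable fun x => φ' (s * x) := hφ'.comp (by fun_prop)
  have hm₁ (s : ℝ) : Measurable fun x => x * φ (s * x) := measurable_id.mul (hm s)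
  have hm₁' (s : ℝ) : Measurable fun x => x * φ' (s * x) := measurable_id.mul (hm' s)
  have hm₂' (s : ℝ) : Measurable fun x => x ^ 2 * φ' (s * x) :=
    (measurable_id.pow_const 2).mul (hm' s)
  have h₁ (s : ℝ) : ∫ y, y i₀ * φ (s * y i₀) ∂(Measure.pi fun i => gaussianReal (c i) 1) =
      ∫ x, x * φ (s * x) ∂gaussianReal 0 1 := by
    rw [integral_comp_eval_pi_gaussianReal c i₀ (hm₁ s), hc]
  have h₂ (s : ℝ) : ∫ y, y i₀ * y i₀ * φ' (s * y i₀) ∂(Measure.pi fun i => gaussianReal (c i) 1) =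
      ∫ x, x ^ 2 * φ' (s * x) ∂gaussianReal 0 1 := by
    simp_rw [← sq]
    rw [integral_comp_eval_pi_gaussianReal c i₀ (hm₂' s), hc]
  obtain ⟨s, hs, hs0, hs0'⟩ := exists_pos_integral_mul_comp_mul_eq_zero (φ' := φ') hodd hneg hpos
    (fun t _ => by
      have hp := measurePreserving_eval (fun i => gaussianReal (c i) 1) i₀
      have h := hInt (Pi.single i₀ 1) (Pi.single i₀ t)
      simp only [single_dotProduct, one_mul] at h
      have h' := (hp.integrable_comp (hm₁ t).aestronglyMeasurable).mp h
      rwa [hc] at h')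
    (fun t ht => by
      have h := hder 0 (Pi.single i₀ 1) (Pi.single i₀ 1) t (by simpa using ht.ne')
      simp only [zero_add, smul_dotProduct, single_dotProduct, one_mul, smul_eq_mul, h₁, h₂] at h
      exact h)
  refine ⟨s, hs, fun i => ?_, _, hs0', fun i j => ?_⟩
  · rcases eq_or_ne i i₀ with rfl | hi
    · rw [h₁, hs0]
    · have h := integral_mul_comp_eval_pi_gaussianReal c hi hi (F := Prod.fst) (by fun_prop) (hm s)
      rw [hc, integral_gaussianReal_zero_one_eq_zero_of_odd fun y => by rw [mul_neg, hodd],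
        mul_zero] at h
      exact h
  · have hmixed {k : ι} (hk : k ≠ i₀) :
        ∫ y, y k * y i₀ * φ' (s * y i₀) ∂(Measure.pi fun i => gaussianReal (c i) 1) = 0 := by
      have h := integral_mul_comp_eval_pi_gaussianReal c hk hk (F := Prod.fst) (by fun_prop)
        (hm₁' s)
      rw [hc, integral_gaussianReal_zero_one_eq_zero_of_odd fun y => by
        rw [mul_neg, heven, neg_mul], mul_zero] at h
      simp_rw [mul_assoc]
      exact h
    by_cases hi : i = i₀ <;> by_cases hj : j = i₀
    · subst hi hj; simp [h₂]
    · subst hi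
      simp only [hj, and_false, if_false]
      rw [← hmixed hj]
      simp_rw [mul_comm (_ : ℝ)]
    · subst hj
      simp only [hi, false_and, if_false]
      exact hmixed hi
    · simp only [hi, hj, and_self, if_false]
      have h := integral_mul_comp_eval_pi_gaussianReal c hi hj (F := fun p => p.1 * p.2)
        (by fun_prop) (hm' s)
      rw [hc, integral_comp_mul_gaussianReal_eq_zero c hi hc hφ hφ' hInt hder hs hs0,
        mul_zero] at h
      exact h

end ProductGaussian

section DotProduct

variable {ι : Type*} [Fintype ι] {m : Measure (ι → ℝ)} {F : (ι → ℝ) → ℝ}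

lemma integrable_dotProduct_mul (hF : ∀ k, Integrable (fun x => x k * F x) m) (v : ι → ℝ) :
    Integrable (fun x => (v ⬝ᵥ x) * F x) m := by
  simp only [dotProduct, Finset.sum_mul, mul_assoc]
  exact integrable_finsetSum _ fun k _ => (hF k).const_mul _

lemma integral_dotProduct_mul (hF : ∀ k, Integrable (fun x => x k * F x) m) (v : ι → ℝ) :
    ∫ x, (v ⬝ᵥ x) * F x ∂m = ∑ k, v k * ∫ x, x k * F x ∂m := by
  simp only [dotProduct, Finset.sum_mul, mul_assoc]
  rw [integral_finsetSum _ fun k _ => (hF k).const_mul _]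
  simp only [integral_const_mul]

lemma integrable_dotProduct_mul_dotProduct_mul
    (hF : ∀ k l, Integrable (fun x => x k * x l * F x) m) (v w : ι → ℝ) :
    Integrable (fun x => (v ⬝ᵥ x) * (w ⬝ᵥ x) * F x) m := by
  simp only [mul_assoc] at hF ⊢
  refine integrable_dotProduct_mul (fun k => ?_) v
  simp only [mul_left_comm (_ : ℝ) (w ⬝ᵥ _)]
  exact integrable_dotProduct_mul (fun l => by simpa only [mul_left_comm] using hF k l) w

lemma integral_dotProduct_mul_dotProduct_mul
    (hF : ∀ k l, Integrable (fun x => x k * x l * F x) m) (v w : ι → ℝ) :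
    ∫ x, (v ⬝ᵥ x) * (w ⬝ᵥ x) * F x ∂m = ∑ k, v k * ∑ l, w l * ∫ x, x k * x l * F x ∂m := by
  simp only [mul_assoc] at hF ⊢
  have hF' (k l : ι) : Integrable (fun x => x l * (x k * F x)) m := by
    simpa only [mul_left_comm] using hF k l
  have hw (k : ι) : ∫ x, x k * ((w ⬝ᵥ x) * F x) ∂m = ∑ l, w l * ∫ x, x k * (x l * F x) ∂m := by
    simp only [mul_left_comm _ (w ⬝ᵥ _)]
    rw [integral_dotProduct_mul (hF' k)]
    simp only [mul_left_comm]
  rw [integral_dotProduct_mul (F := fun x => (w ⬝ᵥ x) * F x)]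
  · simp only [hw]
  · intro k
    simp only [mul_left_comm _ (w ⬝ᵥ _)]
    exact integrable_dotProduct_mul (hF' k) w

/-- Directional form of the second-derivative formula for `b ↦ ∫ f (b ⬝ᵥ x)`. -/
lemma hasDerivAt_integral_dotProduct_mul_comp {φ φ' : ℝ → ℝ}
    (hint1 : ∀ (β : ι → ℝ) (k : ι), Integrable (fun x => x k * φ (β ⬝ᵥ x)) m)
    (hint2 : ∀ (β : ι → ℝ) (k l : ι), Integrable (fun x => x k * x l * φ' (β ⬝ᵥ x)) m)
    (hhess : ∀ β : ι → ℝ, β ≠ 0 → ∀ k : ι,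
      DifferentiableAt ℝ (fun b : ι → ℝ => ∫ x, x k * φ (b ⬝ᵥ x) ∂m) β ∧
      ∀ v : ι → ℝ, fderiv ℝ (fun b : ι → ℝ => ∫ x, x k * φ (b ⬝ᵥ x) ∂m) β v =
        (fun l => ∫ x, x k * x l * φ' (β ⬝ᵥ x) ∂m) ⬝ᵥ v)
    (b w v : ι → ℝ) {t : ℝ} (ht : b + t • w ≠ 0) :
    HasDerivAt (fun t => ∫ x, (v ⬝ᵥ x) * φ ((b + t • w) ⬝ᵥ x) ∂m)
      (∫ x, (v ⬝ᵥ x) * (w ⬝ᵥ x) * φ' ((b + t • w) ⬝ᵥ x) ∂m) t := by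
  simp_rw [fun t => integral_dotProduct_mul (hint1 (b + t • w)) v]
  rw [integral_dotProduct_mul_dotProduct_mul (hint2 (b + t • w)) v w]
  refine HasDerivAt.fun_sum fun k _ => HasDerivAt.const_mul _ ?_
  obtain ⟨hd, hv⟩ := hhess _ ht k
  have hpath : HasDerivAt (fun t : ℝ => b + t • w) w t := by
    simpa using ((hasDerivAt_id t).smul_const w).const_add b
  have h := hd.hasFDerivAt.comp_hasDerivAt t hpath
  rw [hv] at h
  refine h.congr_deriv ?_
  simp only [dotProduct, mul_comm]

end DotProduct

/-- spurious critical points of the population projection pursuit landscape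
`F(β) = E f(βᵀx)`, `x ∼ ½N(μ⋆,Σ⋆)+½N(-μ⋆,Σ⋆)`.  The hypotheses `hgrad`, `hhess` express
that `∇F(β) = E[x f'(βᵀx)]` and `∇²F(β) = E[x xᵀ f''(βᵀx)]` for `β ≠ 0`.  For every
`β ≠ 0` orthogonal to `μ⋆`, there are `t₀ > 0` and `a ≥ 0` with `∇F(t₀β) = 0` and
`∇²F(t₀β) = a (Σ⋆β)(Σ⋆β)ᵀ ⪰ 0`. -/
theorem spurious_critical_point {d : ℕ} (hd : 1 ≤ d)
    (μ : Fin d → ℝ) (S : Matrix (Fin d) (Fin d) ℝ) (hS : S.PosDef)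
    (f : ℝ → ℝ) (hcont : Continuous f) (heven : ∀ t, f t = f (-t))
    (hC2 : ContDiffOn ℝ 2 f {(0 : ℝ)}ᶜ)
    (hliminf : ∃ ε : ℝ, 0 < ε ∧ ∀ᶠ t : ℝ in atTop, ε ≤ deriv f t)
    (hint0 : ∀ β : Fin d → ℝ, Integrable (fun x => f (β ⬝ᵥ x)) (symMix μ S))
    (hint1 : ∀ (β : Fin d → ℝ) (k : Fin d),
      Integrable (fun x => x k * deriv f (β ⬝ᵥ x)) (symMix μ S))
    (hint2 : ∀ (β : Fin d → ℝ) (k l : Fin d),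
      Integrable (fun x => x k * x l * deriv (deriv f) (β ⬝ᵥ x)) (symMix μ S))
    (hgrad : ∀ β : Fin d → ℝ, β ≠ 0 →
      DifferentiableAt ℝ (fun b : Fin d → ℝ => ∫ x, f (b ⬝ᵥ x) ∂(symMix μ S)) β ∧
      ∀ v : Fin d → ℝ,
        fderiv ℝ (fun b : Fin d → ℝ => ∫ x, f (b ⬝ᵥ x) ∂(symMix μ S)) β v =
          (fun k => ∫ x, x k * deriv f (β ⬝ᵥ x) ∂(symMix μ S)) ⬝ᵥ v)
    (hhess : ∀ β : Fin d → ℝ, β ≠ 0 → ∀ k : Fin d,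
      DifferentiableAt ℝ
        (fun b : Fin d → ℝ => ∫ x, x k * deriv f (b ⬝ᵥ x) ∂(symMix μ S)) β ∧
      ∀ v : Fin d → ℝ,
        fderiv ℝ (fun b : Fin d → ℝ => ∫ x, x k * deriv f (b ⬝ᵥ x) ∂(symMix μ S)) β v =
          (fun l => ∫ x, x k * x l * deriv (deriv f) (β ⬝ᵥ x) ∂(symMix μ S)) ⬝ᵥ v)
    (hcase : (∃ L : ℝ, L < 0 ∧ Tendsto (deriv f) (nhdsWithin 0 (Set.Ioi 0)) (nhds L)) ∨
             (∃ L : ℝ, L < 0 ∧ HasDerivAt (deriv f) L 0)) :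
    ∀ β : Fin d → ℝ, β ≠ 0 → β ⬝ᵥ μ = 0 →
      ∃ t₀ : ℝ, 0 < t₀ ∧ ∃ a : ℝ, 0 ≤ a ∧
        (fun k => ∫ x, x k * deriv f ((t₀ • β) ⬝ᵥ x) ∂(symMix μ S)) = 0 ∧
        (Matrix.of fun k l =>
            ∫ x, x k * x l * deriv (deriv f) ((t₀ • β) ⬝ᵥ x) ∂(symMix μ S)) =
          a • Matrix.vecMulVec (S *ᵥ β) (S *ᵥ β) ∧
        (Matrix.of fun k l =>
            ∫ x, x k * x l * deriv (deriv f) ((t₀ • β) ⬝ᵥ x) ∂(symMix μ S)).PosSemidef := by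
  intro β hβ hβμ
  have hodd (t : ℝ) : deriv f (-t) = -deriv f t := by
    have h := deriv_comp_neg f t
    rw [← funext heven] at h
    linarith
  have heven' (t : ℝ) : deriv (deriv f) (-t) = deriv (deriv f) t := by
    have h := deriv_comp_neg (deriv f) t
    simp only [hodd, deriv.fun_neg] at h
    linarith
  have hφ : Measurable (deriv f) := measurable_deriv f
  have hφ' : Measurable (deriv (deriv f)) := measurable_deriv _
  have hneg : ∀ᶠ t in nhdsWithin 0 (Set.Ioi 0), deriv f t < 0 := by
    rcases hcase with ⟨L, hL, h⟩ | ⟨L, hL, h⟩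
    · exact h.eventually_lt_const hL
    · have h0 : deriv f 0 = 0 := by have := hodd 0; rw [neg_zero] at this; linarith
      have hs := (hasDerivAt_iff_tendsto_slope.mp h).mono_left
        (nhdsWithin_mono 0 (show Set.Ioi (0 : ℝ) ⊆ {0}ᶜ from fun u hu => ne_of_gt hu))
      filter_upwards [hs.eventually_lt_const hL, self_mem_nhdsWithin] with t ht ht0
      rw [slope_def_field, h0, sub_zero, sub_zero] at ht
      exact (div_lt_iff₀ ht0).mp ht |>.trans_eq (zero_mul t)
  let i₀ : Fin d := ⟨0, hd⟩
  obtain ⟨A, hAS, r, hr, hAβ⟩ := hS.exists_factor_transpose_mulVec_eq_single hβ i₀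
  have hA : A.det ≠ 0 := by
    have h := hS.det_pos.ne'
    rw [← hAS, det_mul, det_transpose] at h
    exact mul_self_ne_zero.mp h
  have hu : IsUnit A.det := isUnit_iff_ne_zero.mpr hA
  obtain ⟨c, rfl⟩ : ∃ c, μ = A *ᵥ c :=
    ⟨A⁻¹ *ᵥ μ, by rw [mulVec_mulVec, mul_nonsing_inv _ hu, one_mulVec]⟩
  have hAβ' (y : Fin d → ℝ) : β ⬝ᵥ (A *ᵥ y) = r * y i₀ := by
    rw [dotProduct_mulVec, ← mulVec_transpose, hAβ, single_dotProduct]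
  have hc : c i₀ = 0 := by
    rw [hAβ'] at hβμ
    exact (mul_eq_zero.mp hβμ).resolve_left hr.ne'
  subst hAS
  have hinv (p y : Fin d → ℝ) : (p ᵥ* A⁻¹) ⬝ᵥ (A *ᵥ y) = p ⬝ᵥ y := by
    rw [dotProduct_mulVec, vecMul_vecMul, nonsing_inv_mul _ hu, vecMul_one]
  have hdot (p : Fin d → ℝ) : Measurable fun x : Fin d → ℝ => p ⬝ᵥ x :=
    Continuous.measurable (by fun_prop)
  have htr1 (v b : Fin d → ℝ) := integrable_comp_mulVec_and_integral_symMix A hA c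
    (g := fun x => (v ⬝ᵥ x) * deriv f (b ⬝ᵥ x)) ((hdot v).mul (hφ.comp (hdot b)))
    (fun x => by simp only [dotProduct_neg, hodd, neg_mul_neg])
    (integrable_dotProduct_mul (hint1 b) v)
  have htr2 (v w b : Fin d → ℝ) := integrable_comp_mulVec_and_integral_symMix A hA c
    (g := fun x => (v ⬝ᵥ x) * (w ⬝ᵥ x) * deriv (deriv f) (b ⬝ᵥ x))
    (((hdot v).mul (hdot w)).mul (hφ'.comp (hdot b)))
    (fun x => by simp only [dotProduct_neg, heven', neg_mul_neg])
    (integrable_dotProduct_mul_dotProduct_mul (hint2 b) v w)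
  obtain ⟨s, hs, hgrad0, a, ha, hhess0⟩ := exists_spurious_critical_point_pi_gaussianReal c hc
    hφ hφ' hodd heven' hneg hliminf
    (fun p q => by simpa only [hinv] using (htr1 (p ᵥ* A⁻¹) (q ᵥ* A⁻¹)).1)
    (fun b w v t hne => by
      have hne' : b ᵥ* A⁻¹ + t • (w ᵥ* A⁻¹) ≠ 0 := fun h => hne <| by
        rw [← smul_vecMul, ← add_vecMul] at h
        have h' := congrArg (· ᵥ* A) h
        simpa [vecMul_vecMul, nonsing_inv_mul _ hu] using h'
      have h := hasDerivAt_integral_dotProduct_mul_comp hint1 hint2 hhess _ _ (v ᵥ* A⁻¹) hne'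
      simp_rw [(htr2 _ _ _).2, fun t => (htr1 (v ᵥ* A⁻¹) (b ᵥ* A⁻¹ + t • (w ᵥ* A⁻¹))).2,
        ← smul_vecMul, ← add_vecMul, hinv] at h
      exact h)
  have hsr (y : Fin d → ℝ) : ((s / r) • β) ⬝ᵥ (A *ᵥ y) = s * y i₀ := by
    rw [smul_dotProduct, hAβ', smul_eq_mul]; field_simp
  have hi1 (k : Fin d) : Integrable (fun y => y k * deriv f (s * y i₀))
      (Measure.pi fun i => gaussianReal (c i) 1) := by
    simpa only [hinv, hsr, single_dotProduct, one_mul] using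
      (htr1 (Pi.single k 1 ᵥ* A⁻¹) ((s / r) • β)).1
  have hi2 (k l : Fin d) : Integrable (fun y => y k * y l * deriv (deriv f) (s * y i₀))
      (Measure.pi fun i => gaussianReal (c i) 1) := by
    simpa only [hinv, hsr, single_dotProduct, one_mul] using
      (htr2 (Pi.single k 1 ᵥ* A⁻¹) (Pi.single l 1 ᵥ* A⁻¹) ((s / r) • β)).1
  have hgrad1 (k : Fin d) :
      ∫ x, x k * deriv f (((s / r) • β) ⬝ᵥ x) ∂(symMix (A *ᵥ c) (A * Aᵀ)) = 0 := by
    have h := (htr1 (Pi.single k 1) ((s / r) • β)).2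
    simp only [single_dotProduct, one_mul, hsr] at h
    rw [h]
    refine (integral_dotProduct_mul hi1 (A k)).trans ?_
    simp [hgrad0]
  have hSβ (k : Fin d) : ((A * Aᵀ) *ᵥ β) k = r * A k i₀ := by
    rw [← mulVec_mulVec, hAβ, mulVec_single]
    simp [mul_comm]
  have hhess1 : (Matrix.of fun k l => ∫ x, x k * x l * deriv (deriv f) (((s / r) • β) ⬝ᵥ x)
        ∂(symMix (A *ᵥ c) (A * Aᵀ))) =
      (a / r ^ 2) • vecMulVec ((A * Aᵀ) *ᵥ β) ((A * Aᵀ) *ᵥ β) := by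
    ext k l
    have h := (htr2 (Pi.single k 1) (Pi.single l 1) ((s / r) • β)).2
    simp only [single_dotProduct, one_mul, hsr] at h
    rw [of_apply, h]
    refine (integral_dotProduct_mul_dotProduct_mul hi2 (A k) (A l)).trans ?_
    simp only [hhess0, Matrix.smul_apply, vecMulVec_apply, hSβ, smul_eq_mul]
    rw [Finset.sum_eq_single i₀ (fun i _ hi => by simp [hi]) (by simp),
      Finset.sum_eq_single i₀ (fun i _ hi => by simp [hi]) (by simp)]
    simp only [and_self, if_true]
    field_simp
  refine ⟨s / r, by positivity, a / r ^ 2, by positivity, funext hgrad1, hhess1, ?_⟩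
  rw [hhess1]
  exact (posSemidef_vecMulVec_self_star _).smul (by positivity)
end
end

section
/- Let K ≥ 2, let μ_1*, …, μ_K*, μ̂_1, …, μ̂_K ∈ ℝ^d, and let y_1*, …, y_n*, ŷ_1, …, ŷ_n ∈ [K]. Define M* = (μ_1*, …, μ_K*)^T ∈ ℝ^{K×d}, M̂ = (μ̂_1, …, μ̂_K)^T ∈ ℝ^{K×d}, Y* ∈ {0,1}^{n×K} with i-th row e_{y_i*}^T, Ŷ ∈ {0,1}^{n×K} with i-th row e_{ŷ_i}^T, n_min = min_{j ∈ [K]} |{i : y_i* = j}|, and Δ = min_{j ≠ k} ‖μ_j* − μ_k*‖_2. Assume n_min ≥ 1, Δ > 0, and ‖Ŷ M̂ − Y* M*‖_F² ≤ n_min Δ² / (16 K). Then there exists a permutation τ of [K] such that ∑_{j=1}^K ‖μ_j* − μ̂_{τ(j)}‖_2² ≤ (K / n_min) ‖Ŷ M̂ − Y* M*‖_F² and |{i ∈ [n] : ŷ_i ≠ τ(y_i*)}| ≤ (16 / Δ²) ‖Ŷ M̂ − Y* M*‖_F². -/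
open Real Matrix

noncomputable section

/-- Squared Euclidean norm. -/
def sqnorm {m : ℕ} (v : Fin m → ℝ) : ℝ := ∑ i, v i ^ 2

/-- Euclidean norm. -/
def vnorm {m : ℕ} (v : Fin m → ℝ) : ℝ := Real.sqrt (sqnorm v)

/-- One-hot membership matrix of a label vector: row `i` is `e_{y i}ᵀ`. -/
def oneHot {n K : ℕ} (y : Fin n → Fin K) : Matrix (Fin n) (Fin K) ℝ :=
  Matrix.of fun i j => if y i = j then 1 else 0

/-- Squared Frobenius norm. -/
def frobSq {m k : ℕ} (A : Matrix (Fin m) (Fin k) ℝ) : ℝ := ∑ i, ∑ j, A i j ^ 2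

theorem sqnorm_nonneg {m : ℕ} (v : Fin m → ℝ) : 0 ≤ sqnorm v :=
  Finset.sum_nonneg fun _ _ => sq_nonneg _

theorem vnorm_sq {m : ℕ} (v : Fin m → ℝ) : vnorm v ^ 2 = sqnorm v :=
  Real.sq_sqrt (sqnorm_nonneg v)

theorem sqnorm_sub_comm {m : ℕ} (a b : Fin m → ℝ) : sqnorm (a - b) = sqnorm (b - a) :=
  Finset.sum_congr rfl fun i _ => by simp only [Pi.sub_apply]; ring

theorem sqnorm_sub_le {m : ℕ} (a b c : Fin m → ℝ) :
    sqnorm (a - c) ≤ 2 * sqnorm (a - b) + 2 * sqnorm (b - c) := by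
  simp only [sqnorm, Finset.mul_sum, ← Finset.sum_add_distrib, Pi.sub_apply]
  refine Finset.sum_le_sum fun i _ => ?_
  nlinarith [sq_nonneg (a i - b i - (b i - c i))]

theorem frobSq_oneHot_mul_sub {n d K : ℕ} (μs μh : Fin K → Fin d → ℝ) (ys yh : Fin n → Fin K) :
    frobSq (oneHot yh * Matrix.of μh - oneHot ys * Matrix.of μs) =
      ∑ i, sqnorm (μs (ys i) - μh (yh i)) := by
  refine Finset.sum_congr rfl fun i _ => ?_
  rw [sqnorm_sub_comm]
  refine Finset.sum_congr rfl fun l _ => ?_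
  simp [oneHot, Matrix.mul_apply]

/-- Sending each true center to its nearest estimated center costs at most the total error
divided by the smallest class size. -/
theorem mul_sum_sqnorm_le {n d K N : ℕ} (μs μh : Fin K → Fin d → ℝ) (ys yh : Fin n → Fin K)
    (hN : ∀ j, N ≤ Nat.card {i : Fin n // ys i = j}) (σ : Fin K → Fin K)
    (hσ : ∀ j k, sqnorm (μs j - μh (σ j)) ≤ sqnorm (μs j - μh k)) :
    (N : ℝ) * ∑ j, sqnorm (μs j - μh (σ j)) ≤ ∑ i, sqnorm (μs (ys i) - μh (yh i)) := by
  calc (N : ℝ) * ∑ j, sqnorm (μs j - μh (σ j))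
      = ∑ j, (N : ℝ) * sqnorm (μs j - μh (σ j)) := Finset.mul_sum _ _ _
    _ ≤ ∑ j, ∑ i with ys i = j, sqnorm (μs j - μh (σ j)) := by
        refine Finset.sum_le_sum fun j _ => ?_
        rw [Finset.sum_const, nsmul_eq_mul]
        refine mul_le_mul_of_nonneg_right ?_ (sqnorm_nonneg _)
        have := hN j
        rw [Nat.card_eq_fintype_card, Fintype.card_subtype] at this
        exact_mod_cast this
    _ ≤ ∑ j, ∑ i with ys i = j, sqnorm (μs (ys i) - μh (yh i)) := by
        refine Finset.sum_le_sum fun j _ => Finset.sum_le_sum fun i hi => ?_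
        obtain rfl := (Finset.mem_filter.1 hi).2
        exact hσ _ _
    _ = ∑ i, sqnorm (μs (ys i) - μh (yh i)) := Finset.sum_fiberwise _ _ _

/-- alignment of estimated centers and labels.  Here `n_min` is the minimum
class size of `y⋆`, `Δ` the minimum pairwise distance between the `μⱼ⋆`, and if
`‖Ŷ M̂ - Y⋆ M⋆‖_F² ≤ n_min Δ²/(16K)` there is a permutation `τ` matching centers within
total squared error `(K/n_min)‖Ŷ M̂ - Y⋆ M⋆‖_F²` and mislabeling at most
`(16/Δ²)‖Ŷ M̂ - Y⋆ M⋆‖_F²` points. -/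
theorem center_and_label_alignment {n d K : ℕ} (hK : 2 ≤ K)
    (μs μh : Fin K → Fin d → ℝ) (ys yh : Fin n → Fin K)
    (hmin : 1 ≤ ⨅ j, Nat.card {i : Fin n // ys i = j})
    (hΔ : 0 < ⨅ p : {p : Fin K × Fin K // p.1 ≠ p.2}, vnorm (μs p.1.1 - μs p.1.2))
    (hclose : frobSq (oneHot yh * Matrix.of μh - oneHot ys * Matrix.of μs) ≤
      ((⨅ j, Nat.card {i : Fin n // ys i = j} : ℕ) : ℝ) *
        (⨅ p : {p : Fin K × Fin K // p.1 ≠ p.2}, vnorm (μs p.1.1 - μs p.1.2)) ^ 2 /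
          (16 * K)) :
    ∃ τ : Equiv.Perm (Fin K),
      (∑ j, sqnorm (μs j - μh (τ j))) ≤
        (K : ℝ) / ((⨅ j, Nat.card {i : Fin n // ys i = j} : ℕ) : ℝ) *
          frobSq (oneHot yh * Matrix.of μh - oneHot ys * Matrix.of μs) ∧
      (Nat.card {i : Fin n // yh i ≠ τ (ys i)} : ℝ) ≤
        16 / (⨅ p : {p : Fin K × Fin K // p.1 ≠ p.2}, vnorm (μs p.1.1 - μs p.1.2)) ^ 2 *
          frobSq (oneHot yh * Matrix.of μh - oneHot ys * Matrix.of μs) := by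
  have : NeZero K := ⟨by omega⟩
  have hN : ∀ j, (⨅ j, Nat.card {i : Fin n // ys i = j}) ≤ Nat.card {i : Fin n // ys i = j} :=
    fun j => ciInf_le (OrderBot.bddBelow _) j
  have hsep : ∀ j k, j ≠ k →
      (⨅ p : {p : Fin K × Fin K // p.1 ≠ p.2}, vnorm (μs p.1.1 - μs p.1.2)) ^ 2 ≤
        sqnorm (μs j - μs k) := by
    intro j k hjk
    rw [← vnorm_sq]
    exact pow_le_pow_left₀ hΔ.le
      (ciInf_le (Set.finite_range _).bddBelow
        (⟨(j, k), hjk⟩ : {p : Fin K × Fin K // p.1 ≠ p.2})) 2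
  rw [frobSq_oneHot_mul_sub] at hclose ⊢
  generalize (⨅ j, Nat.card {i : Fin n // ys i = j}) = N at *
  generalize (⨅ p : {p : Fin K × Fin K // p.1 ≠ p.2}, vnorm (μs p.1.1 - μs p.1.2)) = Δ at *
  have hΔ2 : 0 < Δ ^ 2 := pow_pos hΔ 2
  have hN0 : (0 : ℝ) < N := by exact_mod_cast hmin
  have hK2 : (2 : ℝ) ≤ K := by exact_mod_cast hK
  choose σ hσ using fun j => Finite.exists_min fun k => sqnorm (μs j - μh k)
  have hsum := mul_sum_sqnorm_le μs μh ys yh hN σ hσ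
  have hsmall : ∀ j, sqnorm (μs j - μh (σ j)) ≤ Δ ^ 2 / 32 := by
    intro j
    refine (Finset.single_le_sum (f := fun j => sqnorm (μs j - μh (σ j)))
      (fun _ _ => sqnorm_nonneg _) (Finset.mem_univ j)).trans ?_
    refine le_of_mul_le_mul_left ((hsum.trans hclose).trans ?_) hN0
    rw [mul_div_assoc]
    gcongr
    linarith
  have hinj : Function.Injective σ := by
    intro j k hjk
    by_contra hne
    have h1 := hsep j k hne
    have h2 := sqnorm_sub_le (μs j) (μh (σ j)) (μs k)
    have h3 := hsmall j
    have h4 := hsmall k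
    rw [← hjk, sqnorm_sub_comm] at h4
    linarith
  have hbij := Finite.injective_iff_bijective.1 hinj
  refine ⟨Equiv.ofBijective σ hbij, ?_, ?_⟩
  · simp only [Equiv.ofBijective_apply]
    rw [div_mul_eq_mul_div, le_div_iff₀ hN0, mul_comm]
    refine hsum.trans (le_mul_of_one_le_left ?_ (by linarith))
    exact Finset.sum_nonneg fun _ _ => sqnorm_nonneg _
  · simp only [Equiv.ofBijective_apply]
    rw [div_mul_eq_mul_div, le_div_iff₀ hΔ2, ← div_le_iff₀' (by norm_num), mul_div_assoc,
      Nat.card_eq_fintype_card, Fintype.card_subtype, ← nsmul_eq_mul, ← Finset.sum_const]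
    refine (Finset.sum_le_sum fun i hi => ?_).trans
      (Finset.sum_le_univ_sum_of_nonneg fun i => sqnorm_nonneg (μs (ys i) - μh (yh i)))
    obtain ⟨k, hk⟩ := hbij.2 (yh i)
    have hne : ys i ≠ k := by
      rintro rfl
      exact (Finset.mem_filter.1 hi).2 hk.symm
    have h1 := hsep _ _ hne
    have h2 := sqnorm_sub_le (μs (ys i)) (μh (yh i)) (μs k)
    have h3 := hsmall k
    rw [hk, sqnorm_sub_comm] at h3
    linarith
end
end
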